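/- For every even integer $t \ge 2$, $\liminf_{n \to \infty} \frac{ex(n,n,n,K_{2,t})}{n^{3/2}} \ge \frac{3\sqrt{t-1}}{\sqrt{2}}$, i.e., $ex(n,n,n,K_{2,t}) \ge \frac{3\sqrt{t-1}}{\sqrt{2}}\, n^{3/2} + o(n^{3/2})$. -/

import Mathlib

/-- `exTri t n` is `ex(n,n,n,K_{2,t})`: the maximum number of edges in a 3-partite graph
with three parts each of size `n` (vertex `u` lies in part `u.1`) containing no copy of
`K_{2,t}`, i.e. in which every two distinct vertices have at most `t-1` common
neighbours. -/
noncomputable def exTri (t n : ℕ) : ℕ :=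
  sSup {m | ∃ G : SimpleGraph (Fin 3 × Fin n),
    (∀ u v, G.Adj u v → u.1 ≠ v.1) ∧
    (∀ u v, u ≠ v → (G.commonNeighbors u v).ncard ≤ t - 1) ∧
    G.edgeSet.ncard = m}

open MeasureTheory Filter Topology FourierTransform

/-- The profile of a band-limited minorant: its even extension has Fourier transform
`w ↦ sin (π w) ^ 2 / (π ^ 2 * w ^ 2 * (1 - w ^ 2))`. -/
noncomputable def minorantProfile (x : ℝ) : ℝ :=
  (1 - min x 1) + Real.sin (2 * Real.pi * min x 1) / (2 * Real.pi)

lemma continuous_minorantProfile : Continuous minorantProfile := by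
  unfold minorantProfile; fun_prop

lemma minorantProfile_of_one_le {x : ℝ} (hx : 1 ≤ x) : minorantProfile x = 0 := by
  simp [minorantProfile, min_eq_right hx]

lemma hasCompactSupport_minorantProfile_abs :
    HasCompactSupport fun v : ℝ => (minorantProfile |v| : ℂ) := by
  refine HasCompactSupport.intro (isCompact_Icc (a := (-1 : ℝ)) (b := 1)) fun v hv => ?_
  rw [minorantProfile_of_one_le, Complex.ofReal_zero]
  by_contra! h
  exact hv (Set.mem_Icc.2 (abs_le.1 h.le))

lemma integrable_minorantProfile_abs :
    Integrable fun v : ℝ => (minorantProfile |v| : ℂ) := by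
  refine Continuous.integrable_of_hasCompactSupport ?_ hasCompactSupport_minorantProfile_abs
  have := continuous_minorantProfile
  fun_prop

lemma fourier_minorantProfile_abs (w : ℝ) :
    𝓕 (fun v : ℝ => (minorantProfile |v| : ℂ)) w =
      ((2 * ∫ x in (0 : ℝ)..1, minorantProfile x * Real.cos (2 * Real.pi * w * x) : ℝ) : ℂ) := by
  have hcont := continuous_minorantProfile
  have hint (c : ℝ) : Integrable fun v : ℝ =>
      Complex.exp ((c * v : ℝ) * Complex.I) * (minorantProfile |v| : ℂ) := by
    refine Continuous.integrable_of_hasCompactSupport (by fun_prop) ?_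
    exact hasCompactSupport_minorantProfile_abs.mul_left
  have h1 : 𝓕 (fun v : ℝ => (minorantProfile |v| : ℂ)) w =
      ∫ v : ℝ, Complex.exp ((-(2 * Real.pi * w) * v : ℝ) * Complex.I) *
        (minorantProfile |v| : ℂ) := by
    rw [Real.fourier_real_eq_integral_exp_smul]
    refine integral_congr_ae (.of_forall fun v => ?_)
    simp only [smul_eq_mul]
    congr 3
    push_cast; ring
  have h2 : 𝓕 (fun v : ℝ => (minorantProfile |v| : ℂ)) w =
      ∫ v : ℝ, Complex.exp (((2 * Real.pi * w) * v : ℝ) * Complex.I) *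
        (minorantProfile |v| : ℂ) := by
    rw [h1, ← integral_neg_eq_self]
    refine integral_congr_ae (.of_forall fun v => ?_)
    simp only [abs_neg]
    congr 3
    push_cast; ring
  have h3 : 2 * 𝓕 (fun v : ℝ => (minorantProfile |v| : ℂ)) w =
      ∫ v : ℝ, ((2 * (minorantProfile |v| * Real.cos (2 * Real.pi * w * |v|)) : ℝ) : ℂ) := by
    rw [two_mul]
    nth_rewrite 1 [h1]
    rw [h2, ← integral_add (hint _) (hint _)]
    refine integral_congr_ae (.of_forall fun v => ?_)
    have hc : Real.cos (2 * Real.pi * w * |v|) = Real.cos (2 * Real.pi * w * v) := by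
      rcases abs_choice v with h | h <;> rw [h]
      rw [mul_neg, Real.cos_neg]
    simp only [hc]
    rw [← add_mul]
    push_cast
    rw [Complex.cos]
    ring_nf
  rw [integral_complex_ofReal, integral_const_mul,
    integral_comp_abs (f := fun x => minorantProfile x * Real.cos (2 * Real.pi * w * x))] at h3
  have h4 : ∫ x in Set.Ioi (0 : ℝ), minorantProfile x * Real.cos (2 * Real.pi * w * x) =
      ∫ x in (0 : ℝ)..1, minorantProfile x * Real.cos (2 * Real.pi * w * x) := by
    rw [intervalIntegral.integral_of_le zero_le_one]
    refine (setIntegral_eq_of_subset_of_forall_sdiff_eq_zero measurableSet_Ioi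
      Set.Ioc_subset_Ioi_self fun x hx => ?_)
    rw [minorantProfile_of_one_le, zero_mul]
    by_contra! h
    exact hx.2 ⟨hx.1, h.le⟩
  rw [h4] at h3
  have h5 : (2 : ℂ) ≠ 0 := two_ne_zero
  apply mul_left_cancel₀ h5
  rw [h3]; push_cast; ring

lemma integral_minorantProfile_mul_cos {a : ℝ} (ha : 2 * Real.pi < |a|) :
    ∫ x in (0 : ℝ)..1, minorantProfile x * Real.cos (a * x) =
      -((1 - Real.cos a) * (2 * Real.pi) ^ 2 / (a ^ 2 * (a ^ 2 - (2 * Real.pi) ^ 2))) := by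
  have hpi := Real.pi_pos
  set b := 2 * Real.pi with hb
  have hb0 : 0 < b := by positivity
  have ha0 : a ≠ 0 := by rintro rfl; simp at ha; linarith
  have hab : 0 < a ^ 2 - b ^ 2 := by
    rw [← sq_abs a]; nlinarith
  have hderiv : ∀ x ∈ Set.uIcc (0 : ℝ) 1, HasDerivAt
      (fun x => (1 - x) * (Real.sin (a * x) / a) - Real.cos (a * x) / a ^ 2 +
        (b * (Real.cos (b * x) * Real.cos (a * x)) + a * (Real.sin (b * x) * Real.sin (a * x))) /
          ((a ^ 2 - b ^ 2) * b))
      (minorantProfile x * Real.cos (a * x)) x := by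
    intro x hx
    rw [Set.uIcc_of_le zero_le_one] at hx
    have hax : HasDerivAt (fun x : ℝ => a * x) a x := by
      simpa using (hasDerivAt_id x).const_mul a
    have hbx : HasDerivAt (fun x : ℝ => b * x) b x := by
      simpa using (hasDerivAt_id x).const_mul b
    have h1 := ((hasDerivAt_id x).const_sub 1).mul (hax.sin.div_const a)
    have h2 := hax.cos.div_const (a ^ 2)
    have h3 := (((hbx.cos.mul hax.cos).const_mul b).add
      ((hbx.sin.mul hax.sin).const_mul a)).div_const ((a ^ 2 - b ^ 2) * b)
    refine ((h1.sub h2).add h3).congr_deriv ?_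
    rw [minorantProfile, min_eq_left hx.2, ← hb]
    have := hab.ne'
    simp only [id]
    field_simp
    ring
  rw [intervalIntegral.integral_eq_sub_of_hasDerivAt hderiv]
  · have := hab.ne'
    simp [hb]
    rw [← hb]
    field_simp
    ring
  · have := continuous_minorantProfile
    exact Continuous.intervalIntegrable (by fun_prop) _ _

lemma fourier_minorantProfile_abs_re_nonpos {w : ℝ} (hw : 1 < |w|) :
    (𝓕 (fun v : ℝ => (minorantProfile |v| : ℂ)) w).re ≤ 0 := by
  have hpi := Real.pi_pos
  have ha : 2 * Real.pi < |2 * Real.pi * w| := by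
    rw [abs_mul, abs_of_pos (by positivity)]; nlinarith
  rw [fourier_minorantProfile_abs, Complex.ofReal_re, integral_minorantProfile_mul_cos ha]
  have h1 : 0 ≤ 1 - Real.cos (2 * Real.pi * w) := by linarith [Real.cos_le_one (2 * Real.pi * w)]
  have h2 : 0 ≤ (2 * Real.pi * w) ^ 2 - (2 * Real.pi) ^ 2 := by
    rw [← sq_abs (2 * Real.pi * w)]; nlinarith
  have := div_nonneg (mul_nonneg h1 (sq_nonneg (2 * Real.pi)))
    (mul_nonneg (sq_nonneg (2 * Real.pi * w)) h2)
  linarith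

lemma integrable_fourier_minorantProfile_abs :
    Integrable (𝓕 (fun v : ℝ => (minorantProfile |v| : ℂ))) := by
  have hpi := Real.pi_pos
  set k : ℝ → ℂ := fun v : ℝ => (minorantProfile |v| : ℂ) with hk
  have hcont : Continuous (𝓕 k) := by
    refine VectorFourier.fourierIntegral_continuous Real.continuous_fourierChar ?_
      integrable_minorantProfile_abs
    exact continuous_inner
  set B := ∫ v, ‖k v‖
  have hB : 0 ≤ B := integral_nonneg fun _ => norm_nonneg _
  refine (integrable_inv_one_add_sq.const_mul (5 * B + 5)).mono' hcont.aestronglyMeasurable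
    (.of_forall fun w => ?_)
  rw [← div_eq_mul_inv, le_div_iff₀ (by positivity)]
  by_cases hw : |w| < 2
  · have h1 : ‖𝓕 k w‖ ≤ B := VectorFourier.norm_fourierIntegral_le_integral_norm _ _ _ _ _
    have h2 : w ^ 2 < 4 := by rw [← sq_abs]; nlinarith [abs_nonneg w]
    nlinarith [norm_nonneg (𝓕 k w), sq_nonneg w]
  · push Not at hw
    have ha : 2 * Real.pi < |2 * Real.pi * w| := by
      rw [abs_mul, abs_of_pos (by positivity)]; nlinarith
    have hw2 : 4 ≤ w ^ 2 := by rw [← sq_abs]; nlinarith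
    rw [hk, fourier_minorantProfile_abs, Complex.norm_real,
      integral_minorantProfile_mul_cos ha, mul_neg, norm_neg]
    have h1 : |1 - Real.cos (2 * Real.pi * w)| ≤ 2 := by
      rw [abs_le]; constructor <;>
      linarith [Real.cos_le_one (2 * Real.pi * w), Real.neg_one_le_cos (2 * Real.pi * w)]
    have h3 : 2 * ((1 - Real.cos (2 * Real.pi * w)) * (2 * Real.pi) ^ 2 /
        ((2 * Real.pi * w) ^ 2 * ((2 * Real.pi * w) ^ 2 - (2 * Real.pi) ^ 2))) =
        (1 - Real.cos (2 * Real.pi * w)) / (2 * Real.pi ^ 2 * (w ^ 2 * (w ^ 2 - 1))) := by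
      have : w ^ 2 - 1 ≠ 0 := by linarith
      have : w ≠ 0 := by rintro rfl; norm_num at hw2
      have : (2 * Real.pi * w) ^ 2 - (2 * Real.pi) ^ 2 ≠ 0 := by
        have : (2 * Real.pi * w) ^ 2 - (2 * Real.pi) ^ 2 = (2 * Real.pi) ^ 2 * (w ^ 2 - 1) := by ring
        rw [this]; positivity
      field_simp
    have h4 : 0 < w ^ 2 - 1 := by linarith
    rw [h3, Real.norm_eq_abs, abs_div, abs_of_pos (a := 2 * Real.pi ^ 2 * (w ^ 2 * (w ^ 2 - 1)))
      (by positivity), div_mul_eq_mul_div, div_le_iff₀ (by positivity)]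
    have h5 : 1 + w ^ 2 ≤ w ^ 2 * (w ^ 2 - 1) := by nlinarith
    have h6 : 1 ≤ Real.pi ^ 2 := by nlinarith [Real.pi_gt_three]
    calc _ ≤ 2 * (w ^ 2 * (w ^ 2 - 1)) := mul_le_mul h1 h5 (by positivity) (by norm_num)
      _ ≤ (2 * Real.pi ^ 2) * (w ^ 2 * (w ^ 2 - 1)) := by gcongr; linarith
      _ ≤ _ := by nlinarith [show 0 ≤ 2 * Real.pi ^ 2 * (w ^ 2 * (w ^ 2 - 1)) by positivity]

/-- For every `δ > 0` there is a band-limited function with positive integral whose real part is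
nonpositive outside `[-δ, δ]`. -/
lemma exists_bandlimited_minorant {δ : ℝ} (hδ : 0 < δ) :
    ∃ k : ℝ → ℂ, Continuous k ∧ HasCompactSupport k ∧ Integrable (𝓕 k) ∧ k 0 = 1 ∧
      ∀ w, δ < |w| → (𝓕 k w).re ≤ 0 := by
  have hfourier (w : ℝ) : 𝓕 (fun v : ℝ => (minorantProfile |δ * v| : ℂ)) w =
      ((δ⁻¹ : ℝ) : ℂ) * 𝓕 (fun v : ℝ => (minorantProfile |v| : ℂ)) (δ⁻¹ * w) := by
    rw [Real.fourier_real_eq_integral_exp_smul, Real.fourier_real_eq_integral_exp_smul]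
    have := Measure.integral_comp_mul_left (fun v : ℝ =>
      Complex.exp (↑(-2 * Real.pi * v * (δ⁻¹ * w)) * Complex.I) • (minorantProfile |v| : ℂ)) δ
    rw [abs_of_pos (inv_pos.2 hδ), Complex.real_smul] at this
    rw [← this]
    refine integral_congr_ae (.of_forall fun v => ?_)
    simp only
    congr 4
    field_simp
  refine ⟨fun v => (minorantProfile |δ * v| : ℂ), ?_, ?_, ?_, ?_, ?_⟩
  · have := continuous_minorantProfile
    fun_prop
  · exact hasCompactSupport_minorantProfile_abs.comp_homeomorph
      (Homeomorph.mulLeft₀ δ hδ.ne')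
  · rw [funext hfourier]
    exact (integrable_fourier_minorantProfile_abs.comp_mul_left' (inv_pos.2 hδ).ne').const_mul _
  · simp [minorantProfile]
  · intro w hw
    rw [hfourier, Complex.re_ofReal_mul]
    refine mul_nonpos_of_nonneg_of_nonpos (by positivity)
      (fourier_minorantProfile_abs_re_nonpos ?_)
    rw [abs_mul, abs_of_pos (inv_pos.2 hδ), inv_mul_eq_div, lt_div_iff₀ hδ]
    linarith

lemma LSeries_term_add_two_pi_mul_I (f : ℕ → ℂ) (σ v : ℝ) (n : ℕ) :
    LSeries.term f (σ + 2 * Real.pi * v * Complex.I) n =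
      LSeries.term f σ n * Complex.exp (((-2 * Real.pi * v * Real.log n : ℝ) : ℂ) * Complex.I) := by
  rcases eq_or_ne n 0 with rfl | hn
  · simp
  have hn' : (n : ℂ) ≠ 0 := by exact_mod_cast hn
  rw [LSeries.term_of_ne_zero hn, LSeries.term_of_ne_zero hn, Complex.cpow_add _ _ hn',
    Complex.cpow_def_of_ne_zero hn' (2 * Real.pi * v * Complex.I), div_mul_eq_div_div,
    div_eq_mul_inv (f n / _), ← Complex.exp_neg, ← Complex.natCast_log]
  congr 2
  push_cast
  ring

lemma integral_exp_mul_LSeries_term (f : ℕ → ℂ) (k : ℝ → ℂ) (σ y : ℝ) (n : ℕ) :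
    ∫ v : ℝ, Complex.exp ((2 * Real.pi * v * y : ℝ) * Complex.I) * k v *
        LSeries.term f (σ + 2 * Real.pi * v * Complex.I) n =
      LSeries.term f σ n * 𝓕 k (Real.log n - y) := by
  rw [Real.fourier_real_eq_integral_exp_smul, ← integral_const_mul]
  refine integral_congr_ae (.of_forall fun v => ?_)
  simp only [LSeries_term_add_two_pi_mul_I, smul_eq_mul]
  have : Complex.exp (((-2 * Real.pi * v * (Real.log n - y) : ℝ) : ℂ) * Complex.I) =
      Complex.exp ((2 * Real.pi * v * y : ℝ) * Complex.I) *
      Complex.exp (((-2 * Real.pi * v * Real.log n : ℝ) : ℂ) * Complex.I) := by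
    rw [← Complex.exp_add]
    congr 1
    push_cast
    ring
  rw [this]
  ring

lemma hasSum_LSeries_term_mul_fourier {f : ℕ → ℂ} {k : ℝ → ℂ} (hk : Continuous k)
    (hk' : HasCompactSupport k) {σ : ℝ} (hf : LSeriesSummable f σ) (y : ℝ) :
    HasSum (fun n : ℕ => LSeries.term f σ n * 𝓕 k (Real.log n - y))
      (∫ v : ℝ, Complex.exp ((2 * Real.pi * v * y : ℝ) * Complex.I) * k v *
        LSeries f (σ + 2 * Real.pi * v * Complex.I)) := by
  have hnorm (n : ℕ) (v : ℝ) : ‖Complex.exp ((2 * Real.pi * v * y : ℝ) * Complex.I) * k v *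
      LSeries.term f (σ + 2 * Real.pi * v * Complex.I) n‖ =
      ‖k v‖ * ‖LSeries.term f σ n‖ := by
    rw [LSeries_term_add_two_pi_mul_I, norm_mul, norm_mul, norm_mul,
      Complex.norm_exp_ofReal_mul_I, Complex.norm_exp_ofReal_mul_I, one_mul, mul_one]
  have h := hasSum_integral_of_summable_integral_norm (μ := volume)
    (F := fun (n : ℕ) (v : ℝ) => Complex.exp ((2 * Real.pi * v * y : ℝ) * Complex.I) * k v *
      LSeries.term f (σ + 2 * Real.pi * v * Complex.I) n) ?_ ?_
  · simp only [tsum_mul_left, integral_exp_mul_LSeries_term] at h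
    exact h
  · intro n
    simp only [LSeries_term_add_two_pi_mul_I]
    refine Continuous.integrable_of_hasCompactSupport (by fun_prop) ?_
    exact (hk'.mul_left).mul_right
  · simp only [hnorm, integral_mul_const]
    exact hf.norm.mul_left _

lemma integral_exp_mul_div_eq_integral_fourier {k : ℝ → ℂ} (hk : Continuous k)
    (hk' : HasCompactSupport k) {ε : ℝ} (hε : 0 < ε) (y : ℝ) :
    ∫ v : ℝ, Complex.exp ((2 * Real.pi * v * y : ℝ) * Complex.I) * k v *
        (1 / (ε + 2 * Real.pi * v * Complex.I)) =
      ∫ u in Set.Ioi (0 : ℝ), Complex.exp (-(ε * u : ℝ)) * 𝓕 k (u - y) := by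
  have h1 (v : ℝ) : Complex.exp ((2 * Real.pi * v * y : ℝ) * Complex.I) * k v *
      (1 / (ε + 2 * Real.pi * v * Complex.I)) =
      ∫ u in Set.Ioi (0 : ℝ), Complex.exp ((2 * Real.pi * v * y : ℝ) * Complex.I) * k v *
        Complex.exp (-(ε + 2 * Real.pi * v * Complex.I) * u) := by
    rw [integral_const_mul, integral_exp_mul_complex_Ioi (by simpa using hε), neg_div_neg_eq]
    simp
  simp_rw [h1]
  rw [integral_integral_swap]
  · refine setIntegral_congr_fun measurableSet_Ioi fun u _ => ?_
    rw [Real.fourier_real_eq_integral_exp_smul, ← integral_const_mul]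
    refine integral_congr_ae (.of_forall fun v => ?_)
    simp only [smul_eq_mul]
    rw [mul_right_comm, ← mul_assoc, ← Complex.exp_add, ← Complex.exp_add]
    congr 2
    push_cast
    ring
  · have hexp : Integrable (fun u : ℝ => Real.exp (-ε * u)) (volume.restrict (Set.Ioi 0)) :=
      integrableOn_exp_mul_Ioi (by simpa using hε) 0
    refine ((hk.integrable_of_hasCompactSupport hk').norm.mul_prod hexp).mono' ?_ ?_
    · exact Continuous.aestronglyMeasurable (by unfold Function.uncurry; fun_prop)
    · refine .of_forall fun p => ?_
      simp only [Function.uncurry, norm_mul, Complex.norm_exp_ofReal_mul_I, one_mul]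
      gcongr
      rw [Complex.norm_exp]
      simp

lemma tendsto_setIntegral_Ioi_sub {K : ℝ → ℂ} (hK : Integrable K) :
    Tendsto (fun y : ℝ => ∫ u in Set.Ioi (0 : ℝ), K (u - y)) atTop (𝓝 (∫ u, K u)) := by
  have h1 (y : ℝ) : ∫ u in Set.Ioi (0 : ℝ), K (u - y) =
      ∫ u, (Set.Ioi (-y)).indicator K u := by
    rw [← integral_indicator measurableSet_Ioi,
      ← integral_sub_right_eq_self ((Set.Ioi (-y)).indicator K) y]
    refine integral_congr_ae (.of_forall fun u => ?_)
    simp [Set.indicator]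
  simp_rw [h1]
  refine tendsto_integral_filter_of_dominated_convergence (fun u => ‖K u‖)
    (.of_forall fun y => (hK.indicator measurableSet_Ioi).aestronglyMeasurable)
    (.of_forall fun y => .of_forall fun u => norm_indicator_le_norm_self _ _) hK.norm
    (.of_forall fun u => ?_)
  refine tendsto_const_nhds.congr' ?_
  filter_upwards [eventually_gt_atTop (-u)] with y hy
  rw [Set.indicator_of_mem]
  simp only [Set.mem_Ioi]
  linarith

/-- A Tauberian gap theorem: if a Dirichlet series with nonnegative coefficients extends
continuously to `1 ≤ re s` up to a simple pole at `1` with positive residue, then its support meets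
every interval `[exp (y - δ), exp (y + δ)]` with `y` large. -/
theorem eventually_exists_abs_log_sub_le {a : ℕ → ℝ} (ha : ∀ n, 0 ≤ a n) {c : ℝ} (hc : 0 < c)
    {G : ℂ → ℂ} (hG : ContinuousOn G {s | 1 ≤ s.re})
    (hsum : ∀ σ : ℝ, 1 < σ → LSeriesSummable (fun n => (a n : ℂ)) σ)
    (hL : ∀ s : ℂ, 1 < s.re → LSeries (fun n => (a n : ℂ)) s = c * (1 / (s - 1)) + G s)
    {δ : ℝ} (hδ : 0 < δ) :
    ∀ᶠ y : ℝ in atTop, ∃ n : ℕ, n ≠ 0 ∧ a n ≠ 0 ∧ |Real.log n - y| ≤ δ := by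
  obtain ⟨k, hk, hk', hFk, hk0, hneg⟩ := exists_bandlimited_minorant hδ
  have hkint : Integrable k := hk.integrable_of_hasCompactSupport hk'
  have hGcont (ε : ℝ) (hε : 0 ≤ ε) :
      Continuous fun v : ℝ => G (1 + ε + 2 * Real.pi * v * Complex.I) := by
    refine hG.comp_continuous (by fun_prop) fun v => ?_
    simpa using hε
  obtain ⟨M, hM⟩ : ∃ M, ∀ ε ∈ Set.Icc (0 : ℝ) 1, ∀ v ∈ tsupport k,
      ‖G (1 + ε + 2 * Real.pi * v * Complex.I)‖ ≤ M := by
    have hcpt : IsCompact (Set.Icc (0 : ℝ) 1 ×ˢ tsupport k) := isCompact_Icc.prod hk'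
    obtain ⟨M, hM⟩ := hcpt.exists_bound_of_continuousOn
      (f := fun p : ℝ × ℝ => G (1 + p.1 + 2 * Real.pi * p.2 * Complex.I)) (by
        refine hG.comp (by fun_prop) fun p hp => ?_
        simpa using hp.1.1)
    exact ⟨M, fun ε hε v hv => hM (ε, v) ⟨hε, hv⟩⟩
  -- The two contributions, shifted by `ε` to the right of the critical line.
  set P : ℝ → ℝ → ℂ := fun ε y =>
    ∫ u in Set.Ioi (0 : ℝ), Complex.exp (-(ε * u : ℝ)) * 𝓕 k (u - y) with hP
  set R : ℝ → ℝ → ℂ := fun ε y =>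
    ∫ v : ℝ, Complex.exp ((2 * Real.pi * v * y : ℝ) * Complex.I) * k v *
      G (1 + ε + 2 * Real.pi * v * Complex.I) with hR
  have hident (ε : ℝ) (hε : 0 < ε) (y : ℝ) :
      HasSum (fun n : ℕ => LSeries.term (fun n => (a n : ℂ)) (1 + ε : ℝ) n *
        𝓕 k (Real.log n - y)) (c * P ε y + R ε y) := by
    have hs := hasSum_LSeries_term_mul_fourier hk hk' (hsum (1 + ε) (by linarith)) y
    convert hs using 1
    simp only [hP, hR]
    rw [← integral_exp_mul_div_eq_integral_fourier hk hk' hε, ← integral_const_mul,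
      ← integral_add]
    · refine integral_congr_ae (.of_forall fun v => ?_)
      simp only
      rw [hL _ (by simpa using hε)]
      push_cast
      rw [show (1 + ε + 2 * Real.pi * v * Complex.I - 1 : ℂ) = ε + 2 * Real.pi * v * Complex.I
        by ring]
      ring
    · refine Continuous.integrable_of_hasCompactSupport ?_ ((hk'.mul_left.mul_right).mul_left)
      have hne (v : ℝ) : (ε + 2 * Real.pi * v * Complex.I : ℂ) ≠ 0 := fun h => by
        have := congrArg Complex.re h
        simp at this
        linarith
      fun_prop (disch := exact hne _)
    · have := hGcont ε hε.le
      exact Continuous.integrable_of_hasCompactSupport (.mul (by fun_prop) this)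
        (hk'.mul_left.mul_right)
  have hPlim (y : ℝ) : Tendsto (fun ε => P ε y) (𝓝[>] 0) (𝓝 (P 0 y)) := by
    refine tendsto_integral_filter_of_dominated_convergence (fun u => ‖𝓕 k (u - y)‖) ?_ ?_
      (hFk.comp_sub_right y).norm.integrableOn ?_
    · refine .of_forall fun ε => AEStronglyMeasurable.mul
        (Continuous.aestronglyMeasurable (by fun_prop)) ?_
      exact (hFk.comp_sub_right y).aestronglyMeasurable.restrict
    · filter_upwards [self_mem_nhdsWithin] with ε hε
      filter_upwards [ae_restrict_mem measurableSet_Ioi] with u hu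
      rw [norm_mul]
      refine mul_le_of_le_one_left (norm_nonneg _) ?_
      rw [Complex.norm_exp]
      simp only [Complex.neg_re, Complex.ofReal_re]
      rw [Real.exp_le_one_iff]
      exact neg_nonpos.2 (mul_nonneg (le_of_lt hε) (le_of_lt hu))
    · refine .of_forall fun u => ?_
      have : Continuous fun ε : ℝ => Complex.exp (-(ε * u : ℝ)) * 𝓕 k (u - y) := by fun_prop
      exact (this.tendsto 0).mono_left nhdsWithin_le_nhds
  have hRlim (y : ℝ) : Tendsto (fun ε => R ε y) (𝓝[>] 0) (𝓝 (R 0 y)) := by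
    have hmem : ∀ᶠ ε : ℝ in 𝓝[>] 0, ε ∈ Set.Icc (0 : ℝ) 1 := by
      filter_upwards [Ioo_mem_nhdsGT (zero_lt_one (α := ℝ))] with ε hε
      exact ⟨hε.1.le, hε.2.le⟩
    refine tendsto_integral_filter_of_dominated_convergence (fun v => ‖k v‖ * M) ?_ ?_
      (hkint.norm.mul_const M) ?_
    · filter_upwards [hmem] with ε hε
      exact Continuous.aestronglyMeasurable (.mul (by fun_prop) (hGcont ε hε.1))
    · filter_upwards [hmem] with ε hε
      refine .of_forall fun v => ?_
      rw [norm_mul, norm_mul, Complex.norm_exp_ofReal_mul_I, one_mul]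
      by_cases hv : v ∈ tsupport k
      · gcongr
        exact hM ε hε v hv
      · simp [image_eq_zero_of_notMem_tsupport hv]
    · refine .of_forall fun v => Tendsto.const_mul _ ?_
      have h1 : Tendsto (fun ε : ℝ => (1 + ε + 2 * Real.pi * v * Complex.I : ℂ)) (𝓝[>] 0)
          (𝓝[{s | 1 ≤ s.re}] (1 + (0 : ℝ) + 2 * Real.pi * v * Complex.I)) := by
        refine tendsto_nhdsWithin_iff.2 ⟨?_, ?_⟩
        · have : Continuous fun ε : ℝ => (1 + ε + 2 * Real.pi * v * Complex.I : ℂ) := by fun_prop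
          exact (this.tendsto 0).mono_left nhdsWithin_le_nhds
        · filter_upwards [hmem] with ε hε
          simpa using hε.1
      exact (hG _ (by simp)).tendsto.comp h1
  have hPinf : Tendsto (fun y => P 0 y) atTop (𝓝 1) := by
    have h1 := tendsto_setIntegral_Ioi_sub hFk
    have h2 : ∫ u, 𝓕 k u = 1 := by
      have := hkint.fourierInv_fourier_eq hFk (v := 0) hk.continuousAt
      rw [Real.fourierInv_eq] at this
      simpa [hk0] using this
    rw [h2] at h1
    simpa [hP] using h1
  have hRinf : Tendsto (fun y => R 0 y) atTop (𝓝 0) := by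
    have h1 := (Real.tendsto_integral_exp_smul_cocompact
      (fun v : ℝ => k v * G (1 + (0 : ℝ) + 2 * Real.pi * v * Complex.I))).comp
      (tendsto_neg_atTop_atBot.mono_right atBot_le_cocompact)
    refine h1.congr fun y => ?_
    simp only [hR, Function.comp]
    refine integral_congr_ae (.of_forall fun v => ?_)
    simp only [Circle.smul_def, Real.fourierChar_apply, smul_eq_mul, mul_assoc]
    congr 2
    push_cast
    ring
  have hlim : Tendsto (fun y => (c * P 0 y + R 0 y).re) atTop (𝓝 c) := by
    have := ((hPinf.const_mul (c : ℂ)).add hRinf)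
    simpa [Function.comp_def] using (Complex.continuous_re.tendsto _).comp this
  filter_upwards [hlim.eventually (lt_mem_nhds hc)] with y hy
  by_contra! hno
  refine absurd hy (not_lt.2 ?_)
  refine le_of_tendsto ((Complex.continuous_re.tendsto _).comp
    (((hPlim y).const_mul (c : ℂ)).add (hRlim y))) ?_
  filter_upwards [self_mem_nhdsWithin] with ε hε
  have hre := Complex.hasSum_re (hident ε hε y)
  refine hasSum_le (fun n => ?_) hre (hasSum_zero (α := ℝ) (β := ℕ))
  rcases eq_or_ne n 0 with rfl | hn
  · simp
  rcases eq_or_ne (a n) 0 with han | han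
  · simp [LSeries.term_of_ne_zero hn, han]
  rw [LSeries.term_of_ne_zero hn, ← Complex.ofReal_natCast,
    ← Complex.ofReal_cpow n.cast_nonneg, ← Complex.ofReal_div, Complex.re_ofReal_mul]
  refine mul_nonpos_of_nonneg_of_nonpos ?_ (hneg _ (hno n hn han))
  exact div_nonneg (ha n) (Real.rpow_nonneg n.cast_nonneg _)

lemma eventually_exists_isPrimePow_modEq_one {M : ℕ} (hM : M ≠ 0) {δ : ℝ} (hδ : 0 < δ) :
    ∀ᶠ y : ℝ in atTop, ∃ q : ℕ, IsPrimePow q ∧ q ≡ 1 [MOD M] ∧ |Real.log q - y| ≤ δ := by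
  have : NeZero M := ⟨hM⟩
  have hφ : (0 : ℝ) < (M.totient : ℝ)⁻¹ := by
    have := Nat.totient_pos.2 (Nat.pos_of_ne_zero hM)
    positivity
  have h := eventually_exists_abs_log_sub_le
    (ArithmeticFunction.vonMangoldt.residueClass_nonneg (1 : ZMod M)) hφ
    (ArithmeticFunction.vonMangoldt.continuousOn_LFunctionResidueClassAux (1 : ZMod M))
    (fun σ hσ => LSeriesSummable_of_abscissaOfAbsConv_lt_re
      ((ArithmeticFunction.vonMangoldt.abscissaOfAbsConv_residueClass_le_one _).trans_lt
        (by simpa using mod_cast hσ))) (fun s hs => ?_) hδ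
  · filter_upwards [h] with y ⟨n, _, hn, hy⟩
    have hmem := Set.mem_of_indicator_ne_zero hn
    refine ⟨n, ?_, ?_, hy⟩
    · rw [← ArithmeticFunction.vonMangoldt_ne_zero_iff]
      exact fun h => hn (by simp [Set.indicator, h])
    · rw [← ZMod.natCast_eq_natCast_iff]
      simpa using hmem
  · have := ArithmeticFunction.vonMangoldt.eqOn_LFunctionResidueClassAux
      (isUnit_one (M := ZMod M)) hs
    simp only at this
    rw [this]
    push_cast
    ring

section ThreePartite

lemma ncard_le_of_forall_exists_root {F α : Type*} [Field F] {m : ℕ} (hm : 0 < m) {h : F}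
    {S : Set α} (P : α → F → Prop) (hex : ∀ w ∈ S, ∃ r, r ^ m = h ∧ P w r)
    (huniq : ∀ w w' r, r ^ m = h → P w r → P w' r → w = w') : S.ncard ≤ m := by
  classical
  choose! f hf using hex
  have h1 : S.ncard = (f '' S).ncard := by
    refine (Set.InjOn.ncard_image fun w hw w' hw' hww => ?_).symm
    exact huniq w w' (f w) (hf w hw).1 (hf w hw).2 (hww ▸ (hf w' hw').2)
  have h2 : f '' S ⊆ ((Polynomial.nthRoots m h).toFinset : Set F) := by
    rintro _ ⟨w, hw, rfl⟩
    simpa [Polynomial.mem_nthRoots hm] using (hf w hw).1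
  rw [h1]
  refine (Set.ncard_le_ncard h2 (Finset.finite_toSet _)).trans ?_
  rw [Set.ncard_coe_finset]
  exact (Multiset.toFinset_card_le _).trans (Polynomial.card_nthRoots m h)

variable {F : Type*} [Field F]

/-- The nonzero squares of a field. -/
def IsNonzeroSquare (b : F) : Prop := b ≠ 0 ∧ IsSquare b

lemma IsNonzeroSquare.mul {a b : F} (ha : IsNonzeroSquare a) (hb : IsNonzeroSquare b) :
    IsNonzeroSquare (a * b) :=
  ⟨mul_ne_zero ha.1 hb.1, ha.2.mul hb.2⟩

lemma IsNonzeroSquare.mul_ne {ε a b : F} (hε : ¬IsSquare ε) (ha : IsNonzeroSquare a)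
    (hb : IsNonzeroSquare b) : ε * a ≠ b := by
  intro h
  refine hε ?_
  rw [eq_div_of_mul_eq ha.1 h]
  exact hb.2.div ha.2

/-- Arcs from one part of the graph to the next: `x → y` when `y.1 = ε * x.1 + b` and
`y.2 = x.2 * b ^ m` for a nonzero square `b`. -/
def SquareArc (ε : F) (m : ℕ) {H : Subgroup Fˣ} (x y : F × H) : Prop :=
  ∃ b : F, IsNonzeroSquare b ∧ y.1 = ε * x.1 + b ∧ ((y.2 : Fˣ) : F) = ((x.2 : Fˣ) : F) * b ^ m

/-- The 3-partite graph whose consecutive parts are joined by `SquareArc`. -/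
def squareArcGraph (ε : F) (m : ℕ) (H : Subgroup Fˣ) : SimpleGraph (Fin 3 × (F × H)) where
  Adj u v := (v.1 = u.1 + 1 ∧ SquareArc ε m u.2 v.2) ∨ (u.1 = v.1 + 1 ∧ SquareArc ε m v.2 u.2)
  symm := ⟨fun _ _ h => h.symm⟩
  loopless := ⟨fun u h => by
    have : ∀ i : Fin 3, i ≠ i + 1 := by decide
    rcases h with h | h <;> exact this _ h.1⟩

variable {ε : F} {m : ℕ} {H : Subgroup Fˣ}

lemma squareArcGraph_adj {u v : Fin 3 × (F × H)} : (squareArcGraph ε m H).Adj u v ↔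
    (v.1 = u.1 + 1 ∧ SquareArc ε m u.2 v.2) ∨ (u.1 = v.1 + 1 ∧ SquareArc ε m v.2 u.2) :=
  Iff.rfl

lemma squareArcGraph_fst_ne {u v : Fin 3 × (F × H)} (h : (squareArcGraph ε m H).Adj u v) :
    u.1 ≠ v.1 := by
  have key : ∀ i j : Fin 3, (j = i + 1 ∨ i = j + 1) → i ≠ j := by decide
  exact key _ _ (h.imp And.left And.left)

lemma ncard_commonNeighbors_same_part (hε : ¬IsSquare ε) (hm : 0 < m) (i : Fin 3)
    {x x' : F × H} (hx : x ≠ x') :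
    ((squareArcGraph ε m H).commonNeighbors (i, x) (i, x')).ncard ≤ m := by
  have hε0 : ε ≠ 0 := fun h => hε (h ▸ IsSquare.zero)
  have hx2 : ((x.2 : Fˣ) : F) ≠ 0 := Units.ne_zero _
  have hx2' : ((x'.2 : Fˣ) : F) ≠ 0 := Units.ne_zero _
  refine ncard_le_of_forall_exists_root hm (h := ((x'.2 : Fˣ) : F) / (x.2 : Fˣ))
    (fun w r =>
      (w.1 = i + 1 ∧ ∃ b, IsNonzeroSquare b ∧ b * (1 - r) = ε * (x.1 - x'.1) ∧
        w.2.1 = ε * x'.1 + b ∧ ((w.2.2 : Fˣ) : F) = ((x'.2 : Fˣ) : F) * b ^ m) ∨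
      (i = w.1 + 1 ∧ ∃ b, IsNonzeroSquare b ∧ b * (1 - r) = x.1 - x'.1 ∧
        x.1 = ε * w.2.1 + b ∧ ((x.2 : Fˣ) : F) = ((w.2.2 : Fˣ) : F) * b ^ m)) ?_ ?_
  · rintro w ⟨h1, h2⟩
    rw [SimpleGraph.mem_neighborSet, squareArcGraph_adj] at h1 h2
    have key : ∀ i j : Fin 3, j = i + 1 → i = j + 1 → False := by decide
    rcases h1 with ⟨hw, b, hb, e1, e2⟩ | ⟨hw, b, hb, e1, e2⟩ <;>
      rcases h2 with ⟨hw', b', hb', e1', e2'⟩ | ⟨hw', b', hb', e1', e2'⟩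
    · refine ⟨b / b', ?_, .inl ⟨hw, b', hb', ?_, e1', e2'⟩⟩
      · rw [div_pow, div_eq_div_iff (pow_ne_zero _ hb'.1) hx2]
        simp only at e2 e2'
        linear_combination e2' - e2
      · have := hb'.1
        field_simp
        simp only at e1 e1'
        linear_combination e1 - e1'
    · exact (key _ _ hw hw').elim
    · exact (key _ _ hw' hw).elim
    · refine ⟨b' / b, ?_, .inr ⟨hw, b, hb, ?_, e1, e2⟩⟩
      · rw [div_pow, div_eq_div_iff (pow_ne_zero _ hb.1) hx2]
        simp only at e2 e2'
        rw [e2, e2']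
        ring
      · have := hb.1
        field_simp
        simp only at e1 e1'
        linear_combination e1' - e1
  · intro w w' r hr hw hw'
    have hr1 : 1 - r ≠ 0 := by
      intro h
      have hD : x.1 - x'.1 = 0 := by
        rcases hw with ⟨_, b, hb, e, _⟩ | ⟨_, b, hb, e, _⟩
        · rw [h, mul_zero] at e
          exact (mul_eq_zero.1 e.symm).resolve_left hε0
        · rw [h, mul_zero] at e
          exact e.symm
      rw [← sub_eq_zero.1 h, one_pow, eq_div_iff hx2, one_mul] at hr
      refine hx (Prod.ext (sub_eq_zero.1 hD) (Subtype.ext (Units.ext hr)))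
    rcases hw with ⟨hi, b, hb, e, e1, e2⟩ | ⟨hi, b, hb, e, e1, e2⟩ <;>
      rcases hw' with ⟨hi', b', hb', e', e1', e2'⟩ | ⟨hi', b', hb', e', e1', e2'⟩
    · obtain rfl : b = b' := mul_right_cancel₀ hr1 (e.trans e'.symm)
      exact Prod.ext (hi.trans hi'.symm) (Prod.ext (e1.trans e1'.symm)
        (Subtype.ext (Units.ext (e2.trans e2'.symm))))
    · refine absurd ?_ (IsNonzeroSquare.mul_ne hε hb' hb)
      apply mul_right_cancel₀ hr1
      linear_combination ε * e' - e
    · refine absurd ?_ (IsNonzeroSquare.mul_ne hε hb hb')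
      apply mul_right_cancel₀ hr1
      linear_combination ε * e - e'
    · obtain rfl : b = b' := mul_right_cancel₀ hr1 (e.trans e'.symm)
      refine Prod.ext (add_right_cancel (hi.symm.trans hi')) (Prod.ext ?_
        (Subtype.ext (Units.ext ?_)))
      · apply mul_left_cancel₀ hε0
        linear_combination e1' - e1
      · exact mul_right_cancel₀ (pow_ne_zero m hb.1) (e2.symm.trans e2')

lemma ncard_commonNeighbors_consecutive (hε : ¬IsSquare ε) (hm : 0 < m) (i : Fin 3)
    (x y : F × H) :
    ((squareArcGraph ε m H).commonNeighbors (i, x) (i + 1, y)).ncard ≤ m := by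
  have hy2 : ((y.2 : Fˣ) : F) ≠ 0 := Units.ne_zero _
  refine ncard_le_of_forall_exists_root hm (h := ((x.2 : Fˣ) : F) / (y.2 : Fˣ))
    (fun w r => w.1 = i + 1 + 1 ∧ ∃ b b', IsNonzeroSquare b ∧ IsNonzeroSquare b' ∧ r = b * b' ∧
      x.1 - ε ^ 2 * y.1 = ε * b' + b ∧ w.2.1 = ε * y.1 + b' ∧
        ((w.2.2 : Fˣ) : F) = ((y.2 : Fˣ) : F) * b' ^ m) ?_ ?_
  · rintro w ⟨h1, h2⟩
    rw [SimpleGraph.mem_neighborSet, squareArcGraph_adj] at h1 h2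
    have key₁ : ∀ i j : Fin 3, j = i + 1 → j = i + 1 + 1 → False := by decide
    have key₂ : ∀ i j : Fin 3, j = i + 1 → i + 1 = j + 1 → False := by decide
    have key₃ : ∀ i j : Fin 3, i = j + 1 → i + 1 = j + 1 → False := by decide
    rcases h1 with ⟨hw, b, hb, e1, e2⟩ | ⟨hw, b, hb, e1, e2⟩ <;>
      rcases h2 with ⟨hw', b', hb', e1', e2'⟩ | ⟨hw', b', hb', e1', e2'⟩
    · exact (key₁ _ _ hw hw').elim
    · exact (key₂ _ _ hw hw').elim
    · simp only at e1 e2 e1' e2'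
      refine ⟨b * b', ?_, hw', b, b', hb, hb', rfl, ?_, e1', e2'⟩
      · rw [eq_div_iff hy2, e2, e2']
        ring
      · rw [e1, e1']
        ring
    · exact (key₃ _ _ hw hw').elim
  · rintro w w' r - ⟨hi, b, c, hb, hc, hr, e, e1, e2⟩ ⟨hi', b', c', hb', hc', hr', e', e1', e2'⟩
    obtain rfl : c = c' := by
      by_contra hne
      refine absurd ?_ (IsNonzeroSquare.mul_ne hε (hc.mul hc') (hr ▸ hb.mul hc))
      have hne' : c - c' ≠ 0 := sub_ne_zero.2 hne
      apply mul_left_cancel₀ hne'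
      linear_combination c * c' * (e' - e) - c * hr' + c' * hr
    exact Prod.ext (hi.trans hi'.symm) (Prod.ext (e1.trans e1'.symm)
      (Subtype.ext (Units.ext (e2.trans e2'.symm))))

lemma ncard_commonNeighbors_squareArcGraph (hε : ¬IsSquare ε) (hm : 0 < m)
    {u v : Fin 3 × (F × H)} (huv : u ≠ v) :
    ((squareArcGraph ε m H).commonNeighbors u v).ncard ≤ m := by
  obtain ⟨i, x⟩ := u
  obtain ⟨j, y⟩ := v
  have key : ∀ i j : Fin 3, j = i ∨ j = i + 1 ∨ i = j + 1 := by decide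
  rcases key i j with rfl | rfl | rfl
  · exact ncard_commonNeighbors_same_part hε hm _ fun h => huv (by rw [h])
  · exact ncard_commonNeighbors_consecutive hε hm _ _ _
  · rw [SimpleGraph.commonNeighbors_symm]
    exact ncard_commonNeighbors_consecutive hε hm _ _ _

lemma le_ncard_edgeSet_squareArcGraph [Finite F] :
    3 * (Nat.card F * Nat.card (powMonoidHom (α := Fˣ) (2 * m)).range) *
        Nat.card (powMonoidHom (α := Fˣ) 2).range ≤
      (squareArcGraph ε m (powMonoidHom (α := Fˣ) (2 * m)).range).edgeSet.ncard := by
  set H := (powMonoidHom (α := Fˣ) (2 * m)).range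
  set Q := (powMonoidHom (α := Fˣ) 2).range
  have hmem (b : Q) : (b : Fˣ) ^ m ∈ H := by
    obtain ⟨_, c, rfl⟩ := b
    exact ⟨c, by simp [pow_mul]⟩
  let next (p : (Fin 3 × (F × H)) × Q) : Fin 3 × (F × H) :=
    (p.1.1 + 1, ε * p.1.2.1 + ((p.2 : Fˣ) : F), p.1.2.2 * ⟨_, hmem p.2⟩)
  have hadj (p : (Fin 3 × (F × H)) × Q) : (squareArcGraph ε m H).Adj p.1 (next p) := by
    refine .inl ⟨rfl, ((p.2 : Fˣ) : F), ⟨Units.ne_zero _, ?_⟩, rfl, ?_⟩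
    · obtain ⟨_, _, c, rfl⟩ := p
      exact ⟨c, by simp [sq]⟩
    · simp [next]
  let e (p : (Fin 3 × (F × H)) × Q) : (squareArcGraph ε m H).edgeSet := ⟨s(p.1, next p), hadj p⟩
  have hinj : Function.Injective e := by
    intro p p' h
    have h' : s(p.1, next p) = s(p'.1, next p') := congrArg Subtype.val h
    rcases Sym2.eq_iff.1 h' with ⟨h1, h2⟩ | ⟨h1, h2⟩
    · refine Prod.ext h1 (Subtype.ext (Units.ext ?_))
      have h3 := congrArg (fun z => z.2.1) h2
      simp only [next, h1] at h3
      exact add_left_cancel h3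
    · have key : ∀ i j : Fin 3, i = j + 1 → i + 1 = j → False := by decide
      exact (key _ _ (congrArg Prod.fst h1) (congrArg Prod.fst h2)).elim
  have := Nat.card_le_card_of_injective e hinj
  simpa [Nat.card_prod] using this

end ThreePartite

lemma bddAbove_exTri_set (t n : ℕ) : BddAbove {m | ∃ G : SimpleGraph (Fin 3 × Fin n),
    (∀ u v, G.Adj u v → u.1 ≠ v.1) ∧
    (∀ u v, u ≠ v → (G.commonNeighbors u v).ncard ≤ t - 1) ∧ G.edgeSet.ncard = m} := by
  refine ⟨Nat.card (Sym2 (Fin 3 × Fin n)), ?_⟩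
  rintro _ ⟨G, -, -, rfl⟩
  exact Set.ncard_le_card _

lemma ncard_edgeSet_le_exTri {V : Type*} [Finite V] {t n : ℕ} (hV : Nat.card V ≤ n)
    (G : SimpleGraph (Fin 3 × V)) (hpart : ∀ u v, G.Adj u v → u.1 ≠ v.1)
    (hcom : ∀ u v, u ≠ v → (G.commonNeighbors u v).ncard ≤ t - 1) :
    G.edgeSet.ncard ≤ exTri t n := by
  have := Fintype.ofFinite V
  obtain ⟨g⟩ : Nonempty (V ↪ Fin n) := by
    rw [Function.Embedding.nonempty_iff_card_le]
    simpa [Nat.card_eq_fintype_card] using hV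
  let f : Fin 3 × V ↪ Fin 3 × Fin n := (Function.Embedding.refl _).prodMap g
  refine le_csSup (bddAbove_exTri_set t n) ⟨G.map f, ?_, ?_, ?_⟩
  · rintro _ _ h
    obtain ⟨u, v, huv, rfl, rfl⟩ := (SimpleGraph.map_adj _ _ _ _).1 h
    exact hpart u v huv
  · intro u v huv
    have hsub : ∀ w ∈ (G.map f).commonNeighbors u v, ∃ u' v' w', f u' = u ∧ f v' = v ∧ f w' = w ∧
        w' ∈ G.commonNeighbors u' v' := by
      rintro w ⟨h1, h2⟩
      obtain ⟨u', w', h, rfl, rfl⟩ := (SimpleGraph.map_adj _ _ _ _).1 h1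
      obtain ⟨v', w'', h', rfl, hw⟩ := (SimpleGraph.map_adj _ _ _ _).1 h2
      obtain rfl := f.injective hw
      exact ⟨u', v', w'', rfl, rfl, rfl, h, h'⟩
    rcases Set.eq_empty_or_nonempty ((G.map f).commonNeighbors u v) with h | ⟨w, hw⟩
    · simp [h]
    obtain ⟨u', v', -, rfl, rfl, -, -⟩ := hsub w hw
    have hsub' : (G.map f).commonNeighbors (f u') (f v') ⊆ f '' G.commonNeighbors u' v' := by
      intro w hw
      obtain ⟨u'', v'', w', hu, hv, hw', hmem⟩ := hsub w hw
      rw [f.injective hu, f.injective hv] at hmem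
      exact ⟨w', hmem, hw'⟩
    refine (Set.ncard_le_ncard hsub' (Set.toFinite _)).trans ?_
    rw [Set.ncard_image_of_injective _ f.injective]
    exact hcom u' v' fun h => huv (by rw [h])
  · rw [SimpleGraph.edgeSet_map, Set.ncard_image_of_injective _ (Function.Embedding.injective _)]

lemma le_exTri_of_card_eq {F : Type*} [Field F] [Fintype F] {q m n : ℕ} (hF : Nat.card F = q)
    (hm : 0 < m) (hdvd : 2 * m ∣ q - 1) (hn : q * ((q - 1) / (2 * m)) ≤ n) :
    3 * (q * ((q - 1) / (2 * m))) * ((q - 1) / 2) ≤ exTri (m + 1) n := by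
  have hcard : Nat.card Fˣ = q - 1 := by
    rw [Nat.card_units, hF]
  have hH : Nat.card (powMonoidHom (α := (F)ˣ) (2 * m)).range = (q - 1) / (2 * m) := by
    rw [IsCyclic.card_powMonoidHom_range, hcard, Nat.gcd_eq_right hdvd]
  have hQ : Nat.card (powMonoidHom (α := (F)ˣ) 2).range = (q - 1) / 2 := by
    rw [IsCyclic.card_powMonoidHom_range, hcard, Nat.gcd_eq_right (dvd_of_mul_right_dvd hdvd)]
  obtain ⟨ε, hε⟩ : ∃ ε : F, ¬IsSquare ε := by
    refine FiniteField.exists_nonsquare fun h => ?_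
    rw [FiniteField.even_card_iff_char_two, ← Nat.card_eq_fintype_card, hF] at h
    have := dvd_of_mul_right_dvd hdvd
    have : 1 < q := hF ▸ Finite.one_lt_card
    omega
  have h1 := le_ncard_edgeSet_squareArcGraph (ε := ε) (m := m)
  rw [hH, hQ, hF] at h1
  refine h1.trans (ncard_edgeSet_le_exTri ?_ _ (fun _ _ => squareArcGraph_fst_ne) fun u v huv => ?_)
  · rw [Nat.card_prod, hH, hF]
    exact hn
  · exact ncard_commonNeighbors_squareArcGraph hε hm huv

lemma le_exTri_of_isPrimePow {q m n : ℕ} (hq : IsPrimePow q) (hm : 0 < m)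
    (hmod : q ≡ 1 [MOD 2 * m]) (hn : q * ((q - 1) / (2 * m)) ≤ n) :
    3 * (q * ((q - 1) / (2 * m))) * ((q - 1) / 2) ≤ exTri (m + 1) n := by
  obtain ⟨_⟩ : Nonempty (Field (Fin q)) := by
    rw [Fintype.nonempty_field_iff, Fintype.card_fin]
    exact hq
  exact le_exTri_of_card_eq (Nat.card_fin q) hm
    ((Nat.modEq_iff_dvd' hq.one_lt.le).1 hmod.symm) hn

lemma sq_two_mul_ncard_edgeSet_le {V : Type*} [Fintype V] (G : SimpleGraph V) {s : ℕ}
    (hcom : ∀ u v, u ≠ v → (G.commonNeighbors u v).ncard ≤ s) :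
    (2 * G.edgeSet.ncard) ^ 2 ≤ (s + 1) * Fintype.card V ^ 3 := by
  classical
  have hedge : G.edgeSet.ncard = G.edgeFinset.card := by
    rw [← SimpleGraph.coe_edgeFinset, Set.ncard_coe_finset]
  have hpair (u v : V) : (∑ w : V, if G.Adj w u ∧ G.Adj w v then 1 else 0) ≤
      s + if u = v then Fintype.card V else 0 := by
    rw [Finset.sum_boole, Nat.cast_id]
    split_ifs with h
    · exact (Finset.card_le_univ _).trans (Nat.le_add_left _ _)
    · refine le_trans (le_of_eq ?_) (hcom u v h)
      rw [← Set.ncard_coe_finset]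
      congr 1
      ext w
      simp [SimpleGraph.mem_commonNeighbors, G.adj_comm]
  have hdeg (w : V) : G.degree w ^ 2 =
      ∑ u : V, ∑ v : V, if G.Adj w u ∧ G.Adj w v then 1 else 0 := by
    rw [← G.card_neighborFinset_eq_degree, SimpleGraph.neighborFinset_eq_filter, sq,
      Finset.card_filter, Finset.sum_mul_sum]
    refine Finset.sum_congr rfl fun u _ => Finset.sum_congr rfl fun v _ => ?_
    by_cases h1 : G.Adj w u <;> by_cases h2 : G.Adj w v <;> simp [h1, h2]
  have hsq : ∑ w : V, G.degree w ^ 2 ≤ (s + 1) * Fintype.card V ^ 2 := by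
    calc ∑ w : V, G.degree w ^ 2
        = ∑ u : V, ∑ v : V, ∑ w : V, if G.Adj w u ∧ G.Adj w v then 1 else 0 := by
          simp_rw [hdeg]
          rw [Finset.sum_comm]
          exact Finset.sum_congr rfl fun u _ => Finset.sum_comm
      _ ≤ ∑ u : V, ∑ v : V, (s + if u = v then Fintype.card V else 0) :=
          Finset.sum_le_sum fun u _ => Finset.sum_le_sum fun v _ => hpair u v
      _ = (s + 1) * Fintype.card V ^ 2 := by
          simp [Finset.sum_add_distrib]
          ring
  rw [hedge, ← G.sum_degrees_eq_twice_card_edges]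
  calc (∑ v : V, G.degree v) ^ 2 ≤ Fintype.card V * ∑ v : V, G.degree v ^ 2 :=
        sq_sum_le_card_mul_sum_sq
    _ ≤ Fintype.card V * ((s + 1) * Fintype.card V ^ 2) := Nat.mul_le_mul_left _ hsq
    _ = _ := by ring

lemma sq_exTri_le {t : ℕ} (ht : 1 ≤ t) (n : ℕ) : exTri t n ^ 2 ≤ t * (3 * n) ^ 3 := by
  have hne : {m | ∃ G : SimpleGraph (Fin 3 × Fin n),
      (∀ u v, G.Adj u v → u.1 ≠ v.1) ∧
      (∀ u v, u ≠ v → (G.commonNeighbors u v).ncard ≤ t - 1) ∧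
      G.edgeSet.ncard = m}.Nonempty := by
    refine ⟨_, ⊥, ?_, fun u v _ => ?_, rfl⟩
    · simp
    · have : (⊥ : SimpleGraph (Fin 3 × Fin n)).commonNeighbors u v = ∅ := by
        ext w
        simp
      simp [this]
  obtain ⟨G, -, hcom, hG⟩ := Nat.sSup_mem hne (bddAbove_exTri_set t n)
  have h := sq_two_mul_ncard_edgeSet_le G hcom
  rw [hG, Nat.sub_add_cancel ht, Fintype.card_prod, Fintype.card_fin, Fintype.card_fin] at h
  refine le_trans (Nat.pow_le_pow_left ?_ 2) h
  exact Nat.le_mul_of_pos_left _ two_pos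

lemma exTri_div_le {t : ℕ} (ht : 1 ≤ t) (n : ℕ) :
    (exTri t n : ℝ) / (n : ℝ) ^ (3 / 2 : ℝ) ≤ Real.sqrt (27 * t) := by
  refine div_le_of_le_mul₀ (by positivity) (by positivity) ?_
  refine abs_le_of_sq_le_sq' ?_ (by positivity) |>.2
  have h : ((exTri t n : ℝ)) ^ 2 ≤ t * (3 * n) ^ 3 := by exact_mod_cast sq_exTri_le ht n
  have h2 : ((n : ℝ) ^ (3 / 2 : ℝ)) ^ 2 = (n : ℝ) ^ 3 := by
    rw [← Real.rpow_natCast, ← Real.rpow_mul n.cast_nonneg, ← Real.rpow_natCast]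
    norm_num
  rw [mul_pow, Real.sq_sqrt (by positivity), h2]
  linarith

lemma natCast_rpow_three_halves (n : ℕ) : (n : ℝ) ^ (3 / 2 : ℝ) = n * Real.sqrt n := by
  rw [Real.sqrt_eq_rpow, show (3 / 2 : ℝ) = 1 + 1 / 2 by norm_num,
    Real.rpow_add' n.cast_nonneg (by norm_num), Real.rpow_one]

/-- A prime power `q ≡ 1 [MOD 2 * m]` slightly below `√(2 * m * n)` gives a lower bound on
`exTri (m + 1) n`. -/
lemma mul_le_exTri_div {m n q : ℕ} (hm : 0 < m) (hn : 0 < n) (hq : IsPrimePow q)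
    (hmod : q ≡ 1 [MOD 2 * m]) {X r : ℝ} (hX : X = Real.sqrt (2 * m * n)) (hqX : q ≤ X)
    (hr : 0 ≤ r) (hrq : X * r + 1 ≤ q) :
    3 * Real.sqrt m / Real.sqrt 2 * r ^ 3 ≤
      (exTri (m + 1) n : ℝ) / (n : ℝ) ^ (3 / 2 : ℝ) := by
  obtain ⟨d, hd⟩ : 2 * m ∣ q - 1 := (Nat.modEq_iff_dvd' hq.one_lt.le).1 hmod.symm
  have hd1 : (q - 1) / (2 * m) = d := by rw [hd, Nat.mul_div_cancel_left _ (by omega)]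
  have hd2 : (q - 1) / 2 = m * d := by rw [hd, mul_assoc, Nat.mul_div_cancel_left _ two_pos]
  have hqd : (q : ℝ) - 1 = 2 * m * d := by
    have h : q = 2 * m * d + 1 := by have := hq.one_lt; omega
    rw [h]; push_cast; ring
  have hm' : (0 : ℝ) < m := by exact_mod_cast hm
  have hn' : (0 : ℝ) < n := by exact_mod_cast hn
  have hX0 : 0 ≤ X := hX ▸ Real.sqrt_nonneg _
  have hX2 : X ^ 2 = 2 * m * n := by rw [hX, Real.sq_sqrt (by positivity)]
  have hle : q * d ≤ n := by
    have h1 : (q : ℝ) * (2 * m * d) ≤ 2 * m * n := by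
      rw [← hqd, ← hX2]
      nlinarith [(Nat.cast_nonneg q : (0 : ℝ) ≤ q)]
    have h2 : (q : ℝ) * d ≤ n := by
      refine le_of_mul_le_mul_left ?_ (by positivity : (0 : ℝ) < 2 * m)
      linarith
    exact_mod_cast h2
  have hex := le_exTri_of_isPrimePow (n := n) hq hm hmod (by rwa [hd1])
  rw [hd1, hd2] at hex
  have hex' : 3 * ((q : ℝ) * d) * (m * d) ≤ exTri (m + 1) n := by exact_mod_cast hex
  rw [le_div_iff₀ (Real.rpow_pos_of_pos hn' _), natCast_rpow_three_halves]
  refine le_trans ?_ hex'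
  have hXr : (X * r) ^ 3 ≤ q * (q - 1) ^ 2 := by
    have h0 : 0 ≤ X * r := mul_nonneg hX0 hr
    calc (X * r) ^ 3 = (X * r) * (X * r) ^ 2 := by ring
      _ ≤ (q : ℝ) * ((q : ℝ) - 1) ^ 2 := by gcongr <;> linarith
  have hX3 : X ^ 3 = 2 * m * n * (Real.sqrt 2 * Real.sqrt m * Real.sqrt n) := by
    rw [pow_succ, hX2, hX, Real.sqrt_mul (by positivity), Real.sqrt_mul (by positivity)]
  have h2 : Real.sqrt 2 ^ 2 = 2 := Real.sq_sqrt (by norm_num)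
  have h20 : Real.sqrt 2 ≠ 0 := by positivity
  have hlhs : 3 * Real.sqrt m / Real.sqrt 2 * r ^ 3 * (n * Real.sqrt n) =
      3 / (4 * m) * (X * r) ^ 3 := by
    rw [mul_pow, hX3]
    field_simp
    rw [h2]
    ring
  have hrhs : 3 * ((q : ℝ) * d) * (m * d) = 3 / (4 * m) * (q * (q - 1) ^ 2) := by
    rw [hqd]
    field_simp
    ring
  rw [hlhs, hrhs]
  gcongr

lemma eventually_mul_le_exTri_div {m : ℕ} (hm : 0 < m) {δ : ℝ} (hδ : 0 < δ) :
    ∀ᶠ n : ℕ in atTop,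
      3 * Real.sqrt m / Real.sqrt 2 *
          (Real.exp (-(2 * δ)) - (Real.sqrt (2 * m * n))⁻¹) ^ 3 ≤
        (exTri (m + 1) n : ℝ) / (n : ℝ) ^ (3 / 2 : ℝ) := by
  have hm' : (0 : ℝ) < m := by exact_mod_cast hm
  have hXlim : Tendsto (fun n : ℕ => Real.sqrt (2 * m * n)) atTop atTop :=
    Real.tendsto_sqrt_atTop.comp
      (tendsto_natCast_atTop_atTop.const_mul_atTop (by positivity))
  have hylim : Tendsto (fun n : ℕ => Real.log (Real.sqrt (2 * m * n)) - δ) atTop atTop :=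
    tendsto_atTop_add_const_right _ _ (Real.tendsto_log_atTop.comp hXlim)
  filter_upwards [hylim.eventually (eventually_exists_isPrimePow_modEq_one
    (M := 2 * m) (by omega) hδ), eventually_gt_atTop 0,
    hXlim.eventually_ge_atTop (Real.exp (2 * δ))] with n ⟨q, hq, hmod, hlog⟩ hn hX
  set X := Real.sqrt (2 * m * n) with hXdef
  have hX0 : 0 < X := (Real.exp_pos _).trans_le hX
  have hq0 : (0 : ℝ) < q := by exact_mod_cast hq.pos
  rw [abs_le] at hlog
  refine mul_le_exTri_div hm hn hq hmod hXdef ?_ ?_ ?_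
  · exact (Real.log_le_log_iff hq0 hX0).1 (by linarith)
  · rw [Real.exp_neg, sub_nonneg]
    exact inv_anti₀ (Real.exp_pos _) hX
  · rw [mul_sub, mul_inv_cancel₀ hX0.ne', sub_add_cancel]
    rw [← Real.exp_log hX0, ← Real.exp_add, ← Real.exp_log hq0]
    exact Real.exp_le_exp.2 (by linarith)

/-- For every even `t ≥ 2`,
`liminf_{n→∞} ex(n,n,n,K_{2,t}) / n^{3/2} ≥ 3√(t-1)/√2`. -/
theorem stmt_12 (t : ℕ) (ht : 2 ≤ t) (hteven : Even t) :
    3 * Real.sqrt ((t : ℝ) - 1) / Real.sqrt 2 ≤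
      Filter.liminf (fun n : ℕ => (exTri t n : ℝ) / (n : ℝ) ^ (3 / 2 : ℝ))
        Filter.atTop := by
  obtain ⟨m, rfl⟩ : ∃ m, t = m + 1 := ⟨t - 1, by omega⟩
  have hm : 0 < m := by omega
  have hcob : IsCoboundedUnder (· ≥ ·) atTop
      (fun n : ℕ => (exTri (m + 1) n : ℝ) / (n : ℝ) ^ (3 / 2 : ℝ)) :=
    (isBoundedUnder_of ⟨_, exTri_div_le (Nat.le_add_left 1 m)⟩).isCoboundedUnder_ge
  rw [Nat.cast_add_one, add_sub_cancel_right]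
  refine le_of_forall_lt_imp_le_of_dense fun c hc => ?_
  obtain ⟨δ, hδc, hδ⟩ : ∃ δ : ℝ,
      c < 3 * Real.sqrt m / Real.sqrt 2 * (Real.exp (-(2 * δ)) - 0) ^ 3 ∧ 0 < δ := by
    have hcont : Continuous fun δ : ℝ =>
        3 * Real.sqrt m / Real.sqrt 2 * (Real.exp (-(2 * δ)) - 0) ^ 3 := by fun_prop
    have h := (hcont.tendsto 0).eventually (lt_mem_nhds (a := c) (by simpa using hc))
    exact ((h.filter_mono (nhdsWithin_le_nhds (s := Set.Ioi 0))).and self_mem_nhdsWithin).exists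
  have hXlim : Tendsto (fun n : ℕ => (Real.sqrt (2 * m * n))⁻¹) atTop (𝓝 0) :=
    (Real.tendsto_sqrt_atTop.comp (tendsto_natCast_atTop_atTop.const_mul_atTop
      (by positivity))).inv_tendsto_atTop
  refine le_liminf_of_le hcob ?_
  filter_upwards [eventually_mul_le_exTri_div hm hδ,
    (((hXlim.const_sub _).pow 3).const_mul _).eventually (lt_mem_nhds hδc)] with n h1 h2
  exact h2.le.trans h1
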